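/- For every t ∈ R the following two identities hold in the Clifford algebra Cℓ of the rank-8 split hyperbolic form: (1 + t·v₃v₁*)·(1 − v₄v₃*)·(1 − t·v₃v₁*)·(1 + v₄v₃*) = 1 + t·v₄v₁*, and (1 + t·v₄v₁*)·(1 + v₁v₃)·(1 − t·v₄v₁*)·(1 − v₁v₃) = 1 − t·v₃v₄. Equivalently, in terms of Chevalley generators and the group commutator (A, B) = A·B·A⁻¹·B⁻¹, one has ((X_{−e₁+e₃}(t), X_{−e₃+e₄}(−1)), X_{e₁+e₃}(1)) = X_{e₃+e₄}(−t); this is the computation showing that the triality automorphism θ⁺ sends X_{e₁−e₂}(t) to X_{e₃+e₄}(−t). -/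

import Mathlib

/-! Chevalley generator commutator identities in the Clifford algebra of the split
hyperbolic quadratic form of rank 8 (`n = 4`):
`((X_{−e₁+e₃}(t), X_{−e₃+e₄}(−1)), X_{e₁+e₃}(1)) = X_{e₃+e₄}(−t)`.
Indices are 0-based: `v 0 = v₁, …, v 3 = v₄`. -/

/-- The hyperbolic quadratic form `q (x, g) = g x` on `V × Module.Dual R V`. -/
noncomputable def hypQ (R : Type*) [CommRing R] (V : Type*) [AddCommGroup V] [Module R V] :
    QuadraticForm R (V × Module.Dual R V) :=
  (QuadraticForm.dualProd R V).comp (LinearEquiv.prodComm R V (Module.Dual R V)).toLinearMap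

/-- `v i` is the image in the Clifford algebra of the `i`-th standard basis vector. -/
noncomputable def v (R : Type*) [CommRing R] (i : Fin 4) :
    CliffordAlgebra (hypQ R (Fin 4 → R)) :=
  CliffordAlgebra.ι (hypQ R (Fin 4 → R)) (Pi.single i 1, 0)

/-- `vs i` is the image in the Clifford algebra of the `i`-th dual basis vector. -/
noncomputable def vs (R : Type*) [CommRing R] (i : Fin 4) :
    CliffordAlgebra (hypQ R (Fin 4 → R)) :=
  CliffordAlgebra.ι (hypQ R (Fin 4 → R)) (0, LinearMap.proj i)

/-- If `x² = y² = 0` and `xyx = yxy = 0`, the commutator of `1 + t • x` and `1 - y` is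
`1 + t • (yx - xy)`. -/
theorem one_add_smul_commutator_one_sub {R A : Type*} [CommRing R] [Ring A] [Algebra R A]
    (t : R) {x y : A} (hx : x * x = 0) (hy : y * y = 0) (hxyx : x * y * x = 0)
    (hyxy : y * x * y = 0) :
    (1 + t • x) * (1 - y) * (1 - t • x) * (1 + y) = 1 + t • (y * x - x * y) := by
  rw [mul_assoc] at hxyx hyxy
  simp only [mul_add, add_mul, mul_sub, sub_mul, one_mul, mul_one, smul_mul_assoc,
    mul_smul_comm, mul_assoc, smul_sub, hx, hy, hxyx, hyxy, smul_zero,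
    mul_zero, add_zero, sub_zero]
  abel

/-- The commutator formula for bivectors `ab` and `cd`, where `b, c, d` square to zero, `a` and `d`
form a hyperbolic pair and all other pairs anticommute. -/
theorem one_add_smul_mul_commutator_of_hyperbolic {R A : Type*} [CommRing R] [Ring A]
    [Algebra R A] (t : R) {a b c d : A} (hb : b * b = 0) (hc : c * c = 0)
    (hd : d * d = 0) (hba : b * a = -(a * b)) (hca : c * a = -(a * c)) (hcb : c * b = -(b * c))
    (hdb : d * b = -(b * d)) (hdc : d * c = -(c * d)) (hda : d * a = 1 - a * d) :
    (1 + t • (a * b)) * (1 - c * d) * (1 - t • (a * b)) * (1 + c * d) = 1 + t • (c * b) := by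
  have hb' (z : A) : b * (b * z) = 0 := by rw [← mul_assoc, hb, zero_mul]
  have hc' (z : A) : c * (c * z) = 0 := by rw [← mul_assoc, hc, zero_mul]
  have hba' (z : A) : b * (a * z) = -(a * (b * z)) := by simp only [← mul_assoc, hba, neg_mul]
  have hca' (z : A) : c * (a * z) = -(a * (c * z)) := by simp only [← mul_assoc, hca, neg_mul]
  have hcb' (z : A) : c * (b * z) = -(b * (c * z)) := by simp only [← mul_assoc, hcb, neg_mul]
  have hdc' (z : A) : d * (c * z) = -(c * (d * z)) := by simp only [← mul_assoc, hdc, neg_mul]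
  have hda' (z : A) : d * (a * z) = z - a * (d * z) := by
    simp only [← mul_assoc, hda, sub_mul, one_mul]
  rw [one_add_smul_commutator_one_sub t]
  · congr 2
    simp only [mul_assoc, mul_neg, mul_sub, hca', hcb, hcb', hdb, hda', neg_neg]
    abel
  all_goals
    simp only [mul_assoc, mul_neg, neg_mul, mul_sub, sub_mul, hb, hb', hc', hd, hba', hca', hcb,
      hcb', hdb, hdc', hda', neg_zero, mul_zero, sub_zero, neg_neg]

/-- The defining formula of the hyperbolic form. -/
theorem hypQ_apply {R V : Type*} [CommRing R] [AddCommGroup V] [Module R V]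
    (p : V × Module.Dual R V) : hypQ R V p = p.2 p.1 :=
  rfl

/-- The vectors `v i` anticommute. -/
theorem v_mul_v (R : Type*) [CommRing R] (i j : Fin 4) : v R i * v R j = -(v R j * v R i) := by
  rw [eq_neg_iff_add_eq_zero, v, v, CliffordAlgebra.ι_mul_ι_add_swap]
  simp [hypQ_apply, QuadraticMap.polar]

/-- The vectors `v i` square to zero. -/
theorem v_mul_self (R : Type*) [CommRing R] (i : Fin 4) : v R i * v R i = 0 := by
  rw [v, CliffordAlgebra.ι_sq_scalar]
  simp [hypQ_apply]

/-- The covectors `vs i` anticommute. -/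
theorem vs_mul_vs (R : Type*) [CommRing R] (i j : Fin 4) :
    vs R i * vs R j = -(vs R j * vs R i) := by
  rw [eq_neg_iff_add_eq_zero, vs, vs, CliffordAlgebra.ι_mul_ι_add_swap]
  simp [hypQ_apply, QuadraticMap.polar]

/-- The covectors `vs i` square to zero. -/
theorem vs_mul_self (R : Type*) [CommRing R] (i : Fin 4) : vs R i * vs R i = 0 := by
  rw [vs, CliffordAlgebra.ι_sq_scalar]
  simp [hypQ_apply]

/-- The pairing relation between the vectors `v i` and the covectors `vs j`. -/
theorem v_mul_vs_add_vs_mul_v (R : Type*) [CommRing R] (i j : Fin 4) :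
    v R i * vs R j + vs R j * v R i = if i = j then 1 else 0 := by
  rw [v, vs, CliffordAlgebra.ι_mul_ι_add_swap]
  by_cases h : i = j <;> simp [hypQ_apply, QuadraticMap.polar, h]

/-- Vectors and covectors with distinct indices anticommute. -/
theorem v_mul_vs_of_ne (R : Type*) [CommRing R] {i j : Fin 4} (h : i ≠ j) :
    v R i * vs R j = -(vs R j * v R i) := by
  rw [eq_neg_iff_add_eq_zero, v_mul_vs_add_vs_mul_v, if_neg h]

/-- Covectors and vectors with distinct indices anticommute. -/
theorem vs_mul_v_of_ne (R : Type*) [CommRing R] {i j : Fin 4} (h : i ≠ j) :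
    vs R i * v R j = -(v R j * vs R i) := by
  rw [v_mul_vs_of_ne R h.symm, neg_neg]

/-- A vector and its dual covector form a hyperbolic pair. -/
theorem v_mul_vs_self (R : Type*) [CommRing R] (i : Fin 4) :
    v R i * vs R i = 1 - vs R i * v R i := by
  rw [eq_sub_iff_add_eq, v_mul_vs_add_vs_mul_v, if_pos rfl]

/-- A covector and its dual vector form a hyperbolic pair. -/
theorem vs_mul_v_self (R : Type*) [CommRing R] (i : Fin 4) :
    vs R i * v R i = 1 - v R i * vs R i := by
  rw [v_mul_vs_self, sub_sub_cancel]

/-- `(1 + t·v₃v₁*)·(1 − v₄v₃*)·(1 − t·v₃v₁*)·(1 + v₄v₃*) = 1 + t·v₄v₁*` and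
`(1 + t·v₄v₁*)·(1 + v₁v₃)·(1 − t·v₄v₁*)·(1 − v₁v₃) = 1 − t·v₃v₄`; i.e.
`((X_{−e₁+e₃}(t), X_{−e₃+e₄}(−1)), X_{e₁+e₃}(1)) = X_{e₃+e₄}(−t)` in `Spin₈ ⊂ Cℓ`,
the computation showing that `θ⁺` sends `X_{e₁−e₂}(t)` to `X_{e₃+e₄}(−t)`. -/
theorem spin8_commutator_theta_plus_X_e1_sub_e2 {R : Type*} [CommRing R] (t : R) :
    (1 + t • (v R 2 * vs R 0)) * (1 - v R 3 * vs R 2) *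
        (1 - t • (v R 2 * vs R 0)) * (1 + v R 3 * vs R 2) =
      1 + t • (v R 3 * vs R 0) ∧
    (1 + t • (v R 3 * vs R 0)) * (1 + v R 0 * v R 2) *
        (1 - t • (v R 3 * vs R 0)) * (1 - v R 0 * v R 2) =
      1 - t • (v R 2 * v R 3) := by
  constructor
  · exact one_add_smul_mul_commutator_of_hyperbolic t (vs_mul_self R 0)
      (v_mul_self R 3) (vs_mul_self R 2) (vs_mul_v_of_ne R (by decide)) (v_mul_v R 3 2)
      (v_mul_vs_of_ne R (by decide)) (vs_mul_vs R 2 0) (vs_mul_v_of_ne R (by decide))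
      (vs_mul_v_self R 2)
  · have h := one_add_smul_mul_commutator_of_hyperbolic t (a := vs R 0) (b := -v R 3)
      (c := v R 2) (d := v R 0) (by rw [neg_mul_neg, v_mul_self])
      (v_mul_self R 2) (v_mul_self R 0)
      (by rw [neg_mul, mul_neg, v_mul_vs_of_ne R (by decide)])
      (v_mul_vs_of_ne R (by decide)) (by rw [neg_mul, mul_neg, v_mul_v R 2 3])
      (by rw [neg_mul, mul_neg, v_mul_v R 0 3]) (v_mul_v R 0 2) (v_mul_vs_self R 0)
    rw [mul_neg, mul_neg, ← v_mul_vs_of_ne R (by decide), v_mul_v R 2 0, smul_neg,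
      sub_neg_eq_add, ← sub_eq_add_neg, ← sub_eq_add_neg] at h
    exact h
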